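/- arXiv:math/0512627 — 3 statements merged into one kernel-verified Lean document; each statement's English description precedes it below -/
import Mathlib

section
/- Let X be a topological space, Y a T1 topological space, and for each x ∈ X let U_x be a fixed open set containing x; define the scale Q on X by letting Q(x) be the collection of all open sets W with U_x ⊆ W. Then a map f : X → Y is weakly (Q, T_Y)-continuous at a point x (i.e., for every open set V containing f(x) there exists W ∈ Q(x) with f(W) ⊆ V) if and only if f is constant on U_x, i.e., f(y) = f(x) for all y ∈ U_x. -/
/-- Theorem 3: For a P-structure `Q` given by chosen open neighborhoods `U x` and
a T1 space `Y`, a map `f` is weakly `(Q, T_Y)`-continuous at `x` iff `f` is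
constant on `U x`. -/
theorem weakly_P_structure_continuousAt_iff_constant
    {X Y : Type*} [TopologicalSpace X] [TopologicalSpace Y] [T1Space Y]
    (U : X → Set X) (hU : ∀ x, IsOpen (U x) ∧ x ∈ U x)
    (f : X → Y) (x : X) :
    (∀ V : Set Y, IsOpen V → f x ∈ V →
        ∃ W : Set X, (IsOpen W ∧ U x ⊆ W) ∧ f '' W ⊆ V) ↔
    (∀ y ∈ U x, f y = f x) := by
  constructor
  · intro h y hy
    by_contra hne
    obtain ⟨W, ⟨-, hUW⟩, hW⟩ := h {f y}ᶜ isOpen_compl_singleton fun he => hne he.symm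
    exact hW ⟨y, hUW hy, rfl⟩ rfl
  · rintro h V - hxV
    refine ⟨U x, ⟨(hU x).1, subset_rfl⟩, ?_⟩
    rintro _ ⟨y, hy, rfl⟩
    rwa [h y hy]
end

section
/- Let X be a topological space, Y a T1 topological space, and for each x ∈ X let U_x be a fixed open set containing x; define the scale Q on X by letting Q(x) be the collection of all open sets W with U_x ⊆ W. If a map f : X → Y is weakly (Q, T_Y)-continuous at every point of X (i.e., for every x and every open set V containing f(x) there exists W ∈ Q(x) with f(W) ⊆ V), then f is constant on every connected component of X: for all x, y ∈ X with y in the connected component of x, f(y) = f(x). -/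
/-- Corollary 10: For a P-structure `Q` given by chosen open neighborhoods `U x`
and a T1 space `Y`, a map that is weakly `(Q, T_Y)`-continuous at every point is
constant on every connected component of `X`. -/
theorem weakly_P_structure_continuous_constant_on_components
    {X Y : Type*} [TopologicalSpace X] [TopologicalSpace Y] [T1Space Y]
    (U : X → Set X) (hU : ∀ x, IsOpen (U x) ∧ x ∈ U x)
    (f : X → Y)
    (hf : ∀ x : X, ∀ V : Set Y, IsOpen V → f x ∈ V →
        ∃ W : Set X, (IsOpen W ∧ U x ⊆ W) ∧ f '' W ⊆ V) :
    ∀ x y : X, y ∈ connectedComponent x → f y = f x := by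
  have hloc : IsLocallyConstant f := by
    refine (IsLocallyConstant.iff_exists_open f).2 fun x => ⟨U x, (hU x).1, (hU x).2, ?_⟩
    intro z hz
    by_contra hne
    obtain ⟨W, ⟨-, hUW⟩, hWV⟩ := hf x {f z}ᶜ isOpen_compl_singleton (Ne.symm hne)
    exact hWV ⟨z, hUW hz, rfl⟩ rfl
  intro x y hy
  exact hloc.apply_eq_of_isPreconnected isPreconnected_connectedComponent hy
    mem_connectedComponent
end

section
/- Let X be a metric space, Y a T1 topological space, a > 0 a real number, and f : X → Y a map. Fix x ∈ X. If f is weakly (Q_a, T_Y)-continuous at x, i.e., for every open set V ⊆ Y containing f(x) there exists an open set W ⊆ X containing the closed ball of radius a centered at x with f(W) ⊆ V, then f is constant on the closed ball of radius a centered at x: f(y) = f(x) for every y with dist(y,x) ≤ a. -/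
/-- Corollary 12: In a metric space `X` with the scale `Q_a` and a T1 space `Y`,
a map that is weakly `(Q_a, T_Y)`-continuous at `x` is constant on the closed
ball of radius `a` centered at `x`. -/
theorem weakly_Qa_continuousAt_implies_constant_on_closedBall
    {X Y : Type*} [MetricSpace X] [TopologicalSpace Y] [T1Space Y]
    (a : ℝ) (ha : 0 < a) (f : X → Y) (x : X)
    (hf : ∀ V : Set Y, IsOpen V → f x ∈ V →
        ∃ W : Set X, IsOpen W ∧ Metric.closedBall x a ⊆ W ∧ f '' W ⊆ V) :
    ∀ y ∈ Metric.closedBall x a, f y = f x := by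
  intro y hy
  by_contra hne
  obtain ⟨W, -, hW, hfW⟩ := hf {f y}ᶜ isOpen_compl_singleton fun h => hne h.symm
  exact hfW ⟨y, hW hy, rfl⟩ rfl
end
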